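/- (Lipschitz continuity of the PME in the observation.) Fix an amplitude d ∈ ℝ, a noise scale τ > 0, and a prior q ∈ [0,1]. Then for all r₁, r₂ ∈ ℝ, |ŝ(q, r₁, τ; d) − ŝ(q, r₂, τ; d)| ≤ (|d|/(4τ²))·|r₁ − r₂|; that is, r ↦ ŝ(q, r, τ; d) is Lipschitz continuous with Lipschitz constant |d|/(4τ²). -/

import Mathlib

/-- The posterior mean estimator (PME). -/
noncomputable def pme (d τ q r : ℝ) : ℝ :=
  q * Real.exp (-(r - d)^2 / (2 * τ^2)) /
    (q * Real.exp (-(r - d)^2 / (2 * τ^2)) + (1 - q) * Real.exp (-r^2 / (2 * τ^2)))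

lemma mul_div_add_sq_le_one_fourth {a b : ℝ} (h : 0 < a + b) : a * b / (a + b) ^ 2 ≤ 1 / 4 := by
  rw [div_le_iff₀ (by positivity)]
  nlinarith [sq_nonneg (a - b)]

lemma hasDerivAt_mul_exp_neg_sq_div (c m τ r : ℝ) :
    HasDerivAt (fun x : ℝ => c * Real.exp (-(x - m) ^ 2 / (2 * τ ^ 2)))
      (c * Real.exp (-(r - m) ^ 2 / (2 * τ ^ 2)) * (-(r - m) / τ ^ 2)) r := by
  have h := (((((hasDerivAt_id' r).sub_const m).fun_pow 2).fun_neg.div_const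
    (2 * τ ^ 2)).exp).const_mul c
  refine h.congr_deriv ?_
  by_cases hτ : τ = 0
  · simp [hτ]
  · push_cast
    field_simp

lemma pme_denom_pos {d τ q r : ℝ} (hq0 : 0 ≤ q) (hq1 : q ≤ 1) :
    0 < q * Real.exp (-(r - d) ^ 2 / (2 * τ ^ 2)) +
      (1 - q) * Real.exp (-r ^ 2 / (2 * τ ^ 2)) := by
  rcases hq0.eq_or_lt with rfl | hq
  · simp [Real.exp_pos]
  · have : 0 ≤ 1 - q := sub_nonneg.mpr hq1
    positivity

lemma hasDerivAt_pme {d τ q : ℝ} (hτ : τ ≠ 0) (hq0 : 0 ≤ q) (hq1 : q ≤ 1) (r : ℝ) :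
    HasDerivAt (pme d τ q)
      (q * Real.exp (-(r - d) ^ 2 / (2 * τ ^ 2)) * ((1 - q) * Real.exp (-r ^ 2 / (2 * τ ^ 2))) /
        (q * Real.exp (-(r - d) ^ 2 / (2 * τ ^ 2)) +
          (1 - q) * Real.exp (-r ^ 2 / (2 * τ ^ 2))) ^ 2 * (d / τ ^ 2)) r := by
  have hA := hasDerivAt_mul_exp_neg_sq_div q d τ r
  have hB := hasDerivAt_mul_exp_neg_sq_div (1 - q) 0 τ r
  simp only [sub_zero] at hB
  have hpos := pme_denom_pos (d := d) (τ := τ) (r := r) hq0 hq1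
  have h := hA.fun_div (hA.fun_add hB) hpos.ne'
  refine h.congr_deriv ?_
  generalize q * Real.exp (-(r - d) ^ 2 / (2 * τ ^ 2)) = a at *
  generalize (1 - q) * Real.exp (-r ^ 2 / (2 * τ ^ 2)) = b at *
  have := hpos.ne'
  field_simp
  ring

/-- Lipschitz continuity of the PME in the observation: for fixed amplitude `d`, noise
scale `τ > 0`, and prior `q ∈ [0,1]`, the map `r ↦ ŝ(q, r, τ; d)` is Lipschitz with
constant `|d|/(4τ²)`. -/
theorem pme_lipschitz (d τ q : ℝ) (hτ : 0 < τ) (hq0 : 0 ≤ q) (hq1 : q ≤ 1) :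
    ∀ r₁ r₂ : ℝ, |pme d τ q r₁ - pme d τ q r₂| ≤ (|d| / (4 * τ^2)) * |r₁ - r₂| := by
  intro r₁ r₂
  refine convex_univ.norm_image_sub_le_of_norm_hasDerivWithin_le
    (fun r _ => (hasDerivAt_pme hτ.ne' hq0 hq1 r).hasDerivWithinAt) (fun r _ => ?_)
    (Set.mem_univ r₂) (Set.mem_univ r₁)
  have hq : 0 ≤ 1 - q := sub_nonneg.mpr hq1
  rw [Real.norm_eq_abs, abs_mul, abs_of_nonneg (by positivity), abs_div,
    abs_of_pos (pow_pos hτ 2)]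
  calc _ ≤ 1 / 4 * (|d| / τ ^ 2) := by
        exact mul_le_mul_of_nonneg_right
          (mul_div_add_sq_le_one_fourth (pme_denom_pos hq0 hq1)) (by positivity)
    _ = |d| / (4 * τ ^ 2) := by ring
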